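/- arXiv:2306.05248 — 3 statements merged into one kernel-verified Lean document; each statement's English description precedes it below -/
import Mathlib

section
/- Suppose the sequences u^n, p^n, η^n, s^n satisfy equations (Step 1) and (Step 2) of the scheme for every n ≥ 1. Then for every n ≥ 1 the one-step energy inequality E₀(n) − E₀(n−1) + τ·E₁(n) ≤ 0 holds. -/
open scoped RealInnerProductSpace

theorem two_mul_inner_sub_left {E : Type*} [NormedAddCommGroup E] [InnerProductSpace ℝ E]
    (x y : E) : 2 * ⟪x - y, x⟫ = ‖x‖ ^ 2 - ‖y‖ ^ 2 + ‖x - y‖ ^ 2 := by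
  rw [norm_sub_sq_real, inner_sub_left, real_inner_self_eq_norm_sq, real_inner_comm]
  ring

/-- A weighted Young inequality: the quadratic form with diagonal entries `m * k` and
`t ^ 2 * l / m` and off-diagonal entry `t` is nonnegative when `k * l = 1`. -/
theorem weighted_young_inner {E : Type*} [NormedAddCommGroup E] [InnerProductSpace ℝ E]
    (x y : E) {m k l t : ℝ} (hm : 0 < m) (hk : 0 < k) (hkl : k * l = 1) :
    0 ≤ m * k / 2 * ‖x‖ ^ 2 + t * ⟪y, x⟫ + t ^ 2 * l / (2 * m) * ‖y‖ ^ 2 := by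
  have hl : l = 1 / k := by field_simp; linarith
  have h : m * k / 2 * ‖x‖ ^ 2 + t * ⟪y, x⟫ + t ^ 2 * l / (2 * m) * ‖y‖ ^ 2
      = 1 / (2 * m * k) * ‖(m * k) • x + t • y‖ ^ 2 := by
    rw [norm_add_sq_real, real_inner_smul_left, real_inner_smul_right, norm_smul, norm_smul,
      mul_pow, mul_pow, Real.norm_eq_abs, Real.norm_eq_abs, sq_abs, sq_abs, hl,
      real_inner_comm x y]
    field_simp
  rw [h]
  positivity

/-- the one-step energy inequality `E₀(n) − E₀(n−1) + τ·E₁(n) ≤ 0`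
for the fully discrete kinematically coupled scheme, in an abstract
inner-product-space setting.  Here `γ` abstracts the boundary trace,
`aF` the fluid form `2μ(D(u),D(v))`, `aS` the structure form, `b` the
pressure/divergence form and `B` the boundary stress `(σ(v,q)·n)|_Σ`;
`σⁿ = B(uⁿ, pⁿ)`. -/
theorem stmt_1
    {V Q S : Type*}
    [NormedAddCommGroup V] [InnerProductSpace ℝ V]
    [AddCommGroup Q] [Module ℝ Q]
    [NormedAddCommGroup S] [InnerProductSpace ℝ S]
    (γ : V →ₗ[ℝ] S)
    (aF : V →ₗ[ℝ] V →ₗ[ℝ] ℝ) (haF_symm : ∀ v w, aF v w = aF w v)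
    (haF_pos : ∀ v, 0 ≤ aF v v)
    (aS : S →ₗ[ℝ] S →ₗ[ℝ] ℝ) (haS_symm : ∀ v w, aS v w = aS w v)
    (haS_pos : ∀ v, 0 ≤ aS v v)
    (b : Q →ₗ[ℝ] V →ₗ[ℝ] ℝ)
    (B : V →ₗ[ℝ] Q →ₗ[ℝ] S)
    (ρf ρs εs τ : ℝ) (hρf : 0 < ρf) (hρs : 0 < ρs) (hεs : 0 < εs) (hτ : 0 < τ)
    (β : ℝ) (hβ : 0 ≤ β)
    (β₀ : ℝ) (hβ₀ : β₀ = 1 - (Real.sqrt (4 + β ^ 2) - β) / 2)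
    (u : ℕ → V) (p : ℕ → Q) (η : ℕ → S) (s : ℕ → S)
    -- Step 1 of the scheme
    (step1 : ∀ n, 1 ≤ n →
      (∀ w : S,
        ρs * εs * ⟪τ⁻¹ • (s n - γ (u (n - 1))), w⟫ + aS (η n) w
          = -⟪B (u (n - 1)) (p (n - 1)), w⟫) ∧
      η n = η (n - 1) + τ • s n)
    -- Step 2 of the scheme
    (step2 : ∀ n, 1 ≤ n → ∀ (v : V) (q : Q),
      ρf * ⟪τ⁻¹ • (u n - u (n - 1)), v⟫ + aF (u n) v - b (p n) v + b q (u n)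
        - ⟪B (u n) (p n), γ v⟫
        + ρs * εs * ⟪τ⁻¹ • (γ (u n) - s n), γ v + (τ / (ρs * εs)) • B v q⟫
        + ⟪B (u n) (p n) - B (u (n - 1)) (p (n - 1)),
            γ v + (τ * (1 + β) / (ρs * εs)) • B v q⟫ = 0)
    -- the energies
    (E₀ E₁ : ℕ → ℝ)
    (hE₀ : ∀ n, E₀ n =
      ρf / 2 * ‖u n‖ ^ 2 + 1 / 2 * aS (η n) (η n)
        + τ ^ 2 * (1 + β) / (2 * ρs * εs) * ‖B (u n) (p n)‖ ^ 2
        + ρs * εs / 2 * ‖γ (u n)‖ ^ 2)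
    (hE₁ : ∀ n, 1 ≤ n → E₁ n =
      aF (u n) (u n)
        + ρf / (2 * τ) * ‖u n - u (n - 1)‖ ^ 2
        + ρs * εs / (2 * τ) * ‖s n - γ (u (n - 1))‖ ^ 2
        + ρs * εs * β₀ / (2 * τ) * ‖s n - γ (u n)‖ ^ 2
        + τ * β₀ / (2 * ρs * εs) * ‖B (u n) (p n) - B (u (n - 1)) (p (n - 1))‖ ^ 2
        + τ / 2 * aS (s n) (s n)) :
    ∀ n, 1 ≤ n → E₀ n - E₀ (n - 1) + τ * E₁ n ≤ 0 := by
  intro n hn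
  obtain ⟨h1, hη⟩ := step1 n hn
  have h1 := h1 (s n)
  have h2 := step2 n hn (u n) (p n)
  have hm : 0 < ρs * εs := mul_pos hρs hεs
  rw [hE₀, hE₀, hE₁ n hn]
  have hη0 : η (n - 1) = η n - τ • s n := by rw [hη]; abel
  have hA : aS (η (n - 1)) (η (n - 1))
      = aS (η n) (η n) - 2 * τ * aS (η n) (s n) + τ ^ 2 * aS (s n) (s n) := by
    rw [hη0]
    simp only [map_sub, map_smul, LinearMap.sub_apply, LinearMap.smul_apply, smul_eq_mul]
    rw [haS_symm (s n) (η n)]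
    ring
  rw [hA]
  set σ := B (u n) (p n)
  set σ' := B (u (n - 1)) (p (n - 1))
  set U := γ (u n)
  set U' := γ (u (n - 1))
  have hr : Real.sqrt (4 + β ^ 2) ^ 2 = 4 + β ^ 2 := Real.sq_sqrt (by positivity)
  have hrβ : β < Real.sqrt (4 + β ^ 2) := Real.lt_sqrt_of_sq_lt (by linarith)
  have young := weighted_young_inner (U - s n) (σ - σ') (t := τ) hm
    (k := 1 - β₀) (l := 1 + β - β₀) (by rw [hβ₀]; linarith) (by rw [hβ₀]; linear_combination hr / 4)
  have hs := two_mul_inner_sub_left (s n) U'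
  have hu := two_mul_inner_sub_left (u n) (u (n - 1))
  have hU := two_mul_inner_sub_left U (s n)
  have hσ := two_mul_inner_sub_left σ σ'
  rw [norm_sub_rev (s n) U]
  have h1τ : ρs * εs * ⟪s n - U', s n⟫ + τ * aS (η n) (s n) = -(τ * ⟪σ', s n⟫) := by
    rw [real_inner_smul_left] at h1
    field_simp at h1
    linarith
  have h2τ : ρf * ⟪u n - u (n - 1), u n⟫ + τ * aF (u n) (u n) + ρs * εs * ⟪U - s n, U⟫
      + τ ^ 2 * (1 + β) / (ρs * εs) * ⟪σ - σ', σ⟫ + τ * ⟪σ - σ', U⟫ - τ * ⟪s n, σ⟫ = 0 := by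
    have hc : ⟪U - s n, σ⟫ = ⟪σ, U⟫ - ⟪s n, σ⟫ := by rw [inner_sub_left, real_inner_comm]
    rw [real_inner_smul_left, real_inner_smul_left, inner_add_right, inner_add_right,
      real_inner_smul_right, real_inner_smul_right, hc] at h2
    field_simp at h2 ⊢
    linear_combination h2
  have hcross : ⟪σ - σ', U - s n⟫ = ⟪σ - σ', U⟫ - ⟪s n, σ⟫ + ⟪σ', s n⟫ := by
    rw [inner_sub_right, inner_sub_left σ σ' (s n), real_inner_comm σ (s n)]
    ring
  rw [hcross] at young
  refine le_of_eq_of_le ?_ (neg_nonpos.mpr young)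
  rw [← sub_eq_zero]
  field_simp
  field_simp at h2τ
  linear_combination 2 * (ρs * εs) * h1τ + 2 * h2τ - ρf * (ρs * εs) * hu
    - (ρs * εs) ^ 2 * (hs + hU) - τ ^ 2 * (1 + β) * hσ
end

section
/- Let f : [0,T] → H be continuous and let ω : [0,T] → H be continuously differentiable with ω(t) ∈ D and ω'(t) ∈ D for all t ∈ [0,T], such that t ↦ Bω(t) is differentiable with derivative B(ω'(t)). Suppose ω'(t) + Bω(t) = f(t) for all t ∈ [0,T] and ω(0) = 0. Then ∫₀ᵀ ‖ω'(t)‖² dt ≤ ∫₀ᵀ ‖f(t)‖² dt and ∫₀ᵀ ‖Bω(t)‖² dt ≤ 4·∫₀ᵀ ‖f(t)‖² dt. -/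
open scoped RealInnerProductSpace

/-- the L²-maximal-regularity energy estimate for the abstract
Cauchy problem `ω' + Bω = f`, `ω(0) = 0`, where `B : D → H` is a symmetric
nonnegative linear operator defined on a subspace `D` of a real Hilbert
space `H`. -/
theorem stmt_5 {H : Type*} [NormedAddCommGroup H] [InnerProductSpace ℝ H]
    [CompleteSpace H]
    (D : Submodule ℝ H) (B : D →ₗ[ℝ] H)
    (hB_symm : ∀ x y : D, ⟪B x, (y : H)⟫ = ⟪(x : H), B y⟫)
    (hB_nonneg : ∀ x : D, 0 ≤ ⟪B x, (x : H)⟫)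
    (T : ℝ) (hT : 0 < T)
    (f : ℝ → H) (hf : ContinuousOn f (Set.Icc 0 T))
    (ω ω' : ℝ → D)
    (hω_deriv : ∀ t ∈ Set.Icc 0 T, HasDerivWithinAt ω (ω' t) (Set.Icc 0 T) t)
    (hω'_cont : ContinuousOn ω' (Set.Icc 0 T))
    (hBω_deriv : ∀ t ∈ Set.Icc 0 T,
      HasDerivWithinAt (fun t => B (ω t)) (B (ω' t)) (Set.Icc 0 T) t)
    (heq : ∀ t ∈ Set.Icc 0 T, ((ω' t : H)) + B (ω t) = f t)
    (hω0 : ω 0 = 0) :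
    (∫ t in (0:ℝ)..T, ‖(ω' t : H)‖ ^ 2) ≤ (∫ t in (0:ℝ)..T, ‖f t‖ ^ 2) ∧
    (∫ t in (0:ℝ)..T, ‖B (ω t)‖ ^ 2) ≤ 4 * ∫ t in (0:ℝ)..T, ‖f t‖ ^ 2 := by
  have hω (t) (ht : t ∈ Set.Icc 0 T) :
      HasDerivWithinAt (fun t => (ω t : H)) (ω' t) (Set.Icc 0 T) t :=
    D.subtypeL.hasFDerivAt.comp_hasDerivWithinAt t (hω_deriv t ht)
  have hω'c : ContinuousOn (fun t => (ω' t : H)) (Set.Icc 0 T) :=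
    continuous_subtype_val.comp_continuousOn hω'_cont
  have hBc : ContinuousOn (fun t => B (ω t)) (Set.Icc 0 T) :=
    fun t ht => (hBω_deriv t ht).continuousWithinAt
  have hq (t) (ht : t ∈ Set.Icc 0 T) :
      HasDerivWithinAt (fun t => ⟪B (ω t), (ω t : H)⟫) (2 * ⟪(ω' t : H), B (ω t)⟫)
        (Set.Icc 0 T) t := by
    refine ((hBω_deriv t ht).inner ℝ (hω t ht)).congr_deriv ?_
    rw [hB_symm (ω' t) (ω t), real_inner_comm (ω' t : H) (B (ω t)), two_mul]
  have hint {g : ℝ → ℝ} (hg : ContinuousOn g (Set.Icc 0 T)) :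
      IntervalIntegrable g MeasureTheory.volume 0 T :=
    hg.intervalIntegrable_of_Icc hT.le
  have hcross := hint ((hω'c.inner (𝕜 := ℝ) hBc).const_mul 2)
  have hω'i : IntervalIntegrable (fun t => ‖(ω' t : H)‖ ^ 2) MeasureTheory.volume 0 T :=
    hint (hω'c.norm.pow 2)
  have hBi : IntervalIntegrable (fun t => ‖B (ω t)‖ ^ 2) MeasureTheory.volume 0 T :=
    hint (hBc.norm.pow 2)
  have henergy : ∫ t in (0:ℝ)..T, 2 * ⟪(ω' t : H), B (ω t)⟫ = ⟪B (ω T), (ω T : H)⟫ := by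
    rw [intervalIntegral.integral_eq_sub_of_hasDerivAt_of_le hT.le
      (fun t ht => (hq t ht).continuousWithinAt)
      (fun t ht => (hq t (Set.Ioo_subset_Icc_self ht)).hasDerivAt (Icc_mem_nhds ht.1 ht.2))
      hcross]
    simp [hω0]
  have hsplit : ∫ t in (0:ℝ)..T, ‖f t‖ ^ 2 =
      (∫ t in (0:ℝ)..T, ‖(ω' t : H)‖ ^ 2) + ⟪B (ω T), (ω T : H)⟫ +
        ∫ t in (0:ℝ)..T, ‖B (ω t)‖ ^ 2 := by
    rw [← henergy, ← intervalIntegral.integral_add hω'i hcross,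
      ← intervalIntegral.integral_add (hω'i.add hcross) hBi]
    refine intervalIntegral.integral_congr fun t ht => ?_
    rw [Set.uIcc_of_le hT.le] at ht
    simp only [← heq t ht, norm_add_sq_real]
  have hT_nonneg := hB_nonneg (ω T)
  have hω'_nonneg : 0 ≤ ∫ t in (0:ℝ)..T, ‖(ω' t : H)‖ ^ 2 :=
    intervalIntegral.integral_nonneg hT.le fun t _ => sq_nonneg _
  have hBω_nonneg : 0 ≤ ∫ t in (0:ℝ)..T, ‖B (ω t)‖ ^ 2 :=
    intervalIntegral.integral_nonneg hT.le fun t _ => sq_nonneg _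
  constructor <;> linarith
end

section
/- Let β ≥ 0, τ > 0, c > 0 be real numbers and β₀ := 1 − (√(4+β²) − β)/2. Let S be a real inner product space with inner product (·,·) and norm ‖·‖, and let a, b, u ∈ S (abstracting σⁿ, σⁿ⁻¹ and γuⁿ − sⁿ). Then τ·(b − a, u) − (τ²(1+β)/c)·(a − b, a) ≤ (c(1−β₀)/2)·‖u‖² − (τ²(1+β)/(2c))·(‖a‖² − ‖b‖²) − (τ²β₀/(2c))·‖a − b‖². -/
open scoped RealInnerProductSpace

/-- Weighted Young inequality for the inner product, with weights `p / 2` and `q / 2`, `p * q = 1`. -/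
theorem neg_inner_le_of_mul_eq_one {S : Type*} [NormedAddCommGroup S] [InnerProductSpace ℝ S]
    {p q : ℝ} (hq : 0 ≤ q) (hpq : p * q = 1) (x y : S) :
    -⟪x, y⟫ ≤ q / 2 * ‖x‖ ^ 2 + p / 2 * ‖y‖ ^ 2 := by
  have h : 0 ≤ q / 2 * ‖x + p • y‖ ^ 2 := by positivity
  rw [norm_add_sq_real, inner_smul_right, norm_smul, mul_pow, Real.norm_eq_abs, sq_abs] at h
  linear_combination h + (⟪x, y⟫ + p / 2 * ‖y‖ ^ 2) * hpq

theorem two_mul_inner_sub_left_self {S : Type*} [NormedAddCommGroup S] [InnerProductSpace ℝ S]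
    (a b : S) : 2 * ⟪a - b, a⟫ = ‖a‖ ^ 2 - ‖b‖ ^ 2 + ‖a - b‖ ^ 2 := by
  rw [norm_sub_sq_real, inner_sub_left, real_inner_self_eq_norm_sq, real_inner_comm]
  ring

/-- the crux inequality in the one-step energy estimate of the
stabilized kinematically coupled scheme, with `a = σⁿ`, `b = σⁿ⁻¹`,
`u = γuⁿ − sⁿ` and `c = ρ_s ε_s`. -/
theorem stmt_9 {S : Type*} [NormedAddCommGroup S] [InnerProductSpace ℝ S]
    (β τ c : ℝ) (hβ : 0 ≤ β) (hτ : 0 < τ) (hc : 0 < c)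
    (β₀ : ℝ) (hβ₀ : β₀ = 1 - (Real.sqrt (4 + β ^ 2) - β) / 2)
    (a b u : S) :
    τ * ⟪b - a, u⟫ - τ ^ 2 * (1 + β) / c * ⟪a - b, a⟫ ≤
      c * (1 - β₀) / 2 * ‖u‖ ^ 2
        - τ ^ 2 * (1 + β) / (2 * c) * (‖a‖ ^ 2 - ‖b‖ ^ 2)
        - τ ^ 2 * β₀ / (2 * c) * ‖a - b‖ ^ 2 := by
  have hs : Real.sqrt (4 + β ^ 2) ^ 2 = 4 + β ^ 2 := Real.sq_sqrt (by positivity)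
  have hlt : β < Real.sqrt (4 + β ^ 2) := Real.lt_sqrt_of_sq_lt (by linarith)
  have hq : 0 ≤ (1 + β - β₀) / c := div_nonneg (by linarith) hc.le
  have hmul : (1 - β₀) * (1 + β - β₀) = 1 := by
    rw [hβ₀]
    linear_combination hs / 4
  have hpq : (c * (1 - β₀)) * ((1 + β - β₀) / c) = 1 := by
    rw [mul_assoc, mul_left_comm, mul_div_cancel₀ _ hc.ne', hmul]
  have young := neg_inner_le_of_mul_eq_one hq hpq (τ • (a - b)) u
  rw [real_inner_smul_left, norm_smul, mul_pow, Real.norm_eq_abs, sq_abs] at young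
  have hneg : ⟪b - a, u⟫ = -⟪a - b, u⟫ := by rw [← neg_sub, inner_neg_left]
  rw [hneg]
  linear_combination young - τ ^ 2 * (1 + β) / (2 * c) * two_mul_inner_sub_left_self a b
end
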